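/- arXiv:2511.23424 — 2 statements merged into one kernel-verified Lean document; each statement's English description precedes it below -/
import Mathlib

section
/- Let γ > 1, k ≥ 0, ρ > 0, r > 0 with r·γ < ρ, let T > 0 and λ ≤ 0. Then sup_{τ ∈ [0,T)} ( −e^{−ρτ} F^{*,k}( λ e^{(ρ−r)τ} ) ) = −e^{−ρT} F^{*,k}( λ e^{(ρ−r)T} ), and if λ < 0 this supremum is not attained at any τ ∈ [0,T). -/
/-- The concave conjugate `F^{*,k}(p) = inf_{y ≥ 0} (y·p + (1+k)·y^γ)`. -/
noncomputable def Fstar (γ k p : ℝ) : ℝ :=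
  sInf ((fun y : ℝ => y * p + (1 + k) * y ^ γ) '' Set.Ici (0 : ℝ))

/-- The map `τ ↦ −e^{−ρτ}·F^{*,k}(λ·e^{(ρ−r)τ})`. -/
noncomputable def bonusVal (γ k ρ r lam τ : ℝ) : ℝ :=
  -Real.exp (-ρ * τ) * Fstar γ k (lam * Real.exp ((ρ - r) * τ))

theorem Fstar_mul_rpow {γ k p s : ℝ} (hs : 0 < s) :
    Fstar γ k (p * s ^ (γ - 1)) = s ^ γ * Fstar γ k p := by
  have hmul : s * s ^ (γ - 1) = s ^ γ := by
    rw [Real.rpow_sub_one hs.ne']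
    field_simp
  unfold Fstar
  rw [← smul_eq_mul (s ^ γ), ← Real.sInf_smul_of_nonneg (Real.rpow_nonneg hs.le γ)]
  congr 1
  ext v
  simp only [Set.mem_image, Set.mem_Ici, Set.mem_smul_set, smul_eq_mul, exists_exists_and_eq_and]
  constructor
  · rintro ⟨y, hy, rfl⟩
    refine ⟨y / s, by positivity, ?_⟩
    rw [Real.div_rpow hy hs.le, ← hmul]
    have := (Real.rpow_pos_of_pos hs (γ - 1)).ne'
    field_simp
  · rintro ⟨z, hz, rfl⟩
    refine ⟨s * z, by positivity, ?_⟩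
    rw [Real.mul_rpow hs.le hz, ← hmul]
    ring

theorem Fstar_zero {γ k : ℝ} (hγ : γ ≠ 0) (hk : 0 ≤ k) : Fstar γ k 0 = 0 := by
  refine IsLeast.csInf_eq ⟨⟨0, Set.self_mem_Ici, by simp [Real.zero_rpow hγ]⟩, ?_⟩
  rintro _ ⟨y, hy, rfl⟩
  have := Real.rpow_nonneg hy γ
  simp only [mul_zero, zero_add]
  positivity

theorem rpow_eq_mul_rpow_sub_one {γ y : ℝ} (hγ : γ ≠ 0) (hy : 0 ≤ y) :
    y ^ γ = y * y ^ (γ - 1) := by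
  conv_lhs => rw [← add_sub_cancel 1 γ]
  rw [Real.rpow_add' hy (by simpa using hγ), Real.rpow_one]

theorem bddBelow_image_mul_add_rpow {γ k p : ℝ} (hγ : 1 < γ) (hk : 0 ≤ k) (hp : p ≤ 0) :
    BddBelow ((fun y : ℝ => y * p + (1 + k) * y ^ γ) '' Set.Ici (0 : ℝ)) := by
  set Y := (-p) ^ (γ - 1)⁻¹
  have hY : 0 ≤ Y := Real.rpow_nonneg (by linarith) _
  have hYp : Y ^ (γ - 1) = -p := Real.rpow_inv_rpow (by linarith) (by linarith)
  refine ⟨Y * p, ?_⟩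
  rintro _ ⟨y, hy, rfl⟩
  have hy : 0 ≤ y := hy
  have hpow := Real.rpow_nonneg hy γ
  have hkpow := mul_nonneg hk hpow
  dsimp only
  rcases le_total y Y with h | h
  · nlinarith [mul_le_mul_of_nonpos_right h hp]
  · have hle : -p ≤ y ^ (γ - 1) := hYp ▸ Real.rpow_le_rpow hY h (by linarith)
    have hyγ := rpow_eq_mul_rpow_sub_one (by linarith : γ ≠ 0) hy
    nlinarith [mul_le_mul_of_nonneg_left hle hy, mul_nonpos_of_nonneg_of_nonpos hY hp]

theorem Fstar_neg {γ k p : ℝ} (hγ : 1 < γ) (hk : 0 ≤ k) (hp : p < 0) : Fstar γ k p < 0 := by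
  have hq : 0 < -p / (2 * (1 + k)) := div_pos (by linarith) (by linarith)
  set y := (-p / (2 * (1 + k))) ^ (γ - 1)⁻¹
  have hy : 0 < y := Real.rpow_pos_of_pos hq _
  have hyp : y ^ (γ - 1) = -p / (2 * (1 + k)) := Real.rpow_inv_rpow hq.le (by linarith)
  refine (csInf_le (bddBelow_image_mul_add_rpow hγ hk hp.le) ⟨y, hy.le, rfl⟩).trans_lt ?_
  have hval : y * p + (1 + k) * y ^ γ = y * p / 2 := by
    rw [rpow_eq_mul_rpow_sub_one (by linarith) hy.le, hyp]
    have : 1 + k ≠ 0 := by linarith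
    field_simp
    ring
  dsimp only
  rw [hval]
  linarith [mul_neg_of_pos_of_neg hy hp]

theorem bonusVal_eq {γ : ℝ} (hγ : 1 < γ) (k ρ r lam τ : ℝ) :
    bonusVal γ k ρ r lam τ =
      -Fstar γ k lam * Real.exp ((ρ - r * γ) / (γ - 1) * τ) := by
  have hγ' : γ - 1 ≠ 0 := by linarith
  have hexp : Real.exp ((ρ - r) * τ) = Real.exp ((ρ - r) * τ / (γ - 1)) ^ (γ - 1) := by
    rw [← Real.exp_mul, div_mul_cancel₀ _ hγ']
  have hsum : -ρ * τ + (ρ - r) * τ / (γ - 1) * γ = (ρ - r * γ) / (γ - 1) * τ := by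
    field_simp
    ring
  rw [bonusVal, hexp, Fstar_mul_rpow (Real.exp_pos _), ← Real.exp_mul, ← hsum, Real.exp_add]
  ring

theorem isLUB_image_Ico_of_monotone {f : ℝ → ℝ} (hf : Continuous f) (hmono : Monotone f)
    {a b : ℝ} (hab : a < b) : IsLUB (f '' Set.Ico a b) (f b) := by
  refine isLUB_of_mem_closure ?_ (image_closure_subset_closure_image hf ⟨b, ?_, rfl⟩)
  · rintro _ ⟨x, hx, rfl⟩
    exact hmono hx.2.le
  · rw [closure_Ico hab.ne]
    exact Set.right_mem_Icc.2 hab.le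

/-- for `γ > 1`, `k ≥ 0`, `ρ, r > 0` with `rγ < ρ`, `T > 0` and `λ ≤ 0`,
`sup_{τ ∈ [0,T)} (−e^{−ρτ} F^{*,k}(λ e^{(ρ−r)τ})) = −e^{−ρT} F^{*,k}(λ e^{(ρ−r)T})`,
and if `λ < 0` the supremum is not attained at any `τ ∈ [0,T)`. -/
theorem statement4 (γ k ρ r T lam : ℝ) (hγ : 1 < γ) (hk : 0 ≤ k)
    (hρ : 0 < ρ) (hr : 0 < r) (hreg : r * γ < ρ) (hT : 0 < T) (hlam : lam ≤ 0) :
    sSup (bonusVal γ k ρ r lam '' Set.Ico 0 T) =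
      -Real.exp (-ρ * T) * Fstar γ k (lam * Real.exp ((ρ - r) * T)) ∧
    (lam < 0 → ∀ τ ∈ Set.Ico (0 : ℝ) T,
      bonusVal γ k ρ r lam τ ≠ sSup (bonusVal γ k ρ r lam '' Set.Ico 0 T)) := by
  have hc : 0 < (ρ - r * γ) / (γ - 1) := div_pos (by linarith) (by linarith)
  have hA : 0 ≤ -Fstar γ k lam := by
    rcases hlam.eq_or_lt with rfl | h
    · simp [Fstar_zero (by linarith : γ ≠ 0) hk]
    · linarith [Fstar_neg hγ hk h]
  have hfun : bonusVal γ k ρ r lam =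
      fun τ => -Fstar γ k lam * Real.exp ((ρ - r * γ) / (γ - 1) * τ) :=
    funext (bonusVal_eq hγ k ρ r lam)
  have hcont : Continuous (bonusVal γ k ρ r lam) := by
    rw [hfun]
    fun_prop
  have hmono : Monotone (bonusVal γ k ρ r lam) := by
    rw [hfun]
    intro s t hst
    dsimp only
    gcongr
  have hsup := (isLUB_image_Ico_of_monotone hcont hmono hT).csSup_eq
    ((Set.nonempty_Ico.2 hT).image _)
  refine ⟨hsup, fun hneg τ hτ => ?_⟩
  rw [hsup, hfun]
  have hpos : 0 < -Fstar γ k lam := neg_pos.2 (Fstar_neg hγ hk hneg)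
  exact (mul_lt_mul_of_pos_left
    (Real.exp_lt_exp.2 (mul_lt_mul_of_pos_left hτ.2 hc)) hpos).ne
end

section
/- Let γ > 1, k ≥ 0, ρ > 0, r > 0, T > 0, ā > 0, N ∈ ℕ, and let h : [0, ā] → ℝ be continuous and increasing with h(0) = 0. Define FG_N(λ) := −N e^{−ρT} F^{*,k}( λ e^{(ρ−r)T} ) − e^{−ρT} F^{*,0}( λ e^{(ρ−r)T} ) + ∫₀^T ρ e^{−ρt} G^*( (r/ρ)·λ·e^{(ρ−r)t} ) dt for λ ≤ 0. Then FG_N is convex and continuous on (−∞, 0], FG_N(λ) > 0 for every λ ≤ 0, and FG_N(λ) → ∞ as λ → −∞; in fact FG_N(λ) ≥ e^{−ρT} · ((γ−1)/γ) · γ^{−1/(γ−1)} · ( −λ e^{(ρ−r)T} )^{γ/(γ−1)} for all λ ≤ 0. -/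
/-- The convex dual `G^*(p) = sup_{a ∈ [0, ā]} (a + h(a)·p)`. -/
noncomputable def Gstar (h : ℝ → ℝ) (abar p : ℝ) : ℝ :=
  sSup ((fun a : ℝ => a + h a * p) '' Set.Icc 0 abar)

/-- `FG_N(λ) = −N e^{−ρT} F^{*,k}(λ e^{(ρ−r)T}) − e^{−ρT} F^{*,0}(λ e^{(ρ−r)T})
  + ∫₀^T ρ e^{−ρt} G^*((r/ρ)·λ·e^{(ρ−r)t}) dt`. -/
noncomputable def FGN (γ k ρ r T abar : ℝ) (h : ℝ → ℝ) (N : ℕ) (lam : ℝ) : ℝ :=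
  -(N : ℝ) * Real.exp (-ρ * T) * Fstar γ k (lam * Real.exp ((ρ - r) * T))
    - Real.exp (-ρ * T) * Fstar γ 0 (lam * Real.exp ((ρ - r) * T))
    + ∫ t in (0 : ℝ)..T, ρ * Real.exp (-ρ * t) * Gstar h abar (r / ρ * lam * Real.exp ((ρ - r) * t))

theorem mul_sub_rpow_le_of_nonneg {γ q y : ℝ} (hγ : 1 < γ) (hq : 0 ≤ q) (hy : 0 ≤ y) :
    q * y - y ^ γ ≤ q * (q / γ) ^ (1 / (γ - 1)) := by
  have hγ0 : 0 < γ - 1 := by linarith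
  set c := (q / γ) ^ (1 / (γ - 1)) with hc
  have hc0 : 0 ≤ c := Real.rpow_nonneg (by positivity) _
  have hcq : c ^ (γ - 1) = q / γ := by
    rw [hc, ← Real.rpow_mul (by positivity), one_div_mul_cancel hγ0.ne', Real.rpow_one]
  rcases le_total y c with hyc | hyc
  · nlinarith [mul_le_mul_of_nonneg_left hyc hq, Real.rpow_nonneg hy γ]
  · rcases hc0.eq_or_lt with hc1 | hc1
    · rw [← hc1, Real.zero_rpow hγ0.ne'] at hcq
      have : q = 0 := by
        rcases div_eq_zero_iff.mp hcq.symm with h | h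
        · exact h
        · linarith
      subst this
      simpa using Real.rpow_nonneg hy γ
    · have hB := one_add_mul_self_le_rpow_one_add (s := y / c - 1) (p := γ)
        (by have : 0 ≤ y / c := by positivity
            linarith) hγ.le
      rw [add_sub_cancel, Real.div_rpow hy hc0, le_div_iff₀ (Real.rpow_pos_of_pos hc1 _)] at hB
      have hcγ : c ^ γ = q / γ * c := by
        rw [← hcq, ← Real.rpow_add_one hc1.ne', sub_add_cancel]
      rw [hcγ] at hB
      have hexp : (1 + γ * (y / c - 1)) * (q / γ * c) = q / γ * c + q * y - q * c := by
        field_simp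
        ring
      have : 0 ≤ q / γ * c := by positivity
      linarith

theorem bddBelow_Fstar {γ k : ℝ} (hγ : 1 < γ) (hk : 0 ≤ k) (p : ℝ) :
    BddBelow ((fun y : ℝ => y * p + (1 + k) * y ^ γ) '' Set.Ici (0 : ℝ)) := by
  refine ⟨-(|p| * (|p| / γ) ^ (1 / (γ - 1))), ?_⟩
  rintro _ ⟨y, hy, rfl⟩
  have hy : 0 ≤ y := hy
  have h1 := mul_sub_rpow_le_of_nonneg hγ (abs_nonneg p) hy
  have h2 := mul_le_mul_of_nonneg_left (neg_abs_le p) hy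
  have h3 := mul_nonneg hk (Real.rpow_nonneg hy γ)
  dsimp only
  linarith

theorem Fstar_le {γ k : ℝ} (hγ : 1 < γ) (hk : 0 ≤ k) (p : ℝ) {y : ℝ} (hy : 0 ≤ y) :
    Fstar γ k p ≤ y * p + (1 + k) * y ^ γ :=
  csInf_le (bddBelow_Fstar hγ hk p) ⟨y, hy, rfl⟩

theorem Fstar_nonpos {γ k : ℝ} (hγ : 1 < γ) (hk : 0 ≤ k) (p : ℝ) : Fstar γ k p ≤ 0 := by
  simpa [Real.zero_rpow (show γ ≠ 0 by linarith)] using Fstar_le hγ hk p le_rfl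

theorem concaveOn_Fstar {γ k : ℝ} (hγ : 1 < γ) (hk : 0 ≤ k) :
    ConcaveOn ℝ Set.univ (Fstar γ k) := by
  refine ⟨convex_univ, fun x _ y _ a b ha hb hab => ?_⟩
  refine le_csInf (Set.nonempty_Ici.image _) ?_
  rintro _ ⟨z, hz, rfl⟩
  have h1 := mul_le_mul_of_nonneg_left (Fstar_le hγ hk x hz) ha
  have h2 := mul_le_mul_of_nonneg_left (Fstar_le hγ hk y hz) hb
  have h3 : (1 + k) * z ^ γ = (a + b) * ((1 + k) * z ^ γ) := by rw [hab, one_mul]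
  simp only [smul_eq_mul]
  rw [h3]
  linarith

theorem rpow_le_neg_Fstar {γ p : ℝ} (hγ : 1 < γ) (hp : p ≤ 0) :
    (γ - 1) / γ * γ ^ (-(1 / (γ - 1))) * (-p) ^ (γ / (γ - 1)) ≤ -Fstar γ 0 p := by
  have hγ0 : 0 < γ - 1 := by linarith
  have hγ1 : 0 < γ := by linarith
  obtain ⟨q, rfl⟩ : ∃ q, p = -q := ⟨-p, by ring⟩
  have hq : 0 ≤ q := by linarith
  rw [neg_neg]
  set c := (q / γ) ^ (1 / (γ - 1)) with hc
  have hc0 : 0 ≤ c := Real.rpow_nonneg (by positivity) _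
  have hcq : c ^ (γ - 1) = q / γ := by
    rw [hc, ← Real.rpow_mul (by positivity), one_div_mul_cancel hγ0.ne', Real.rpow_one]
  have hcγ : c ^ γ = q / γ * c := by
    rw [← hcq, ← Real.rpow_add_one' hc0 (by linarith), sub_add_cancel]
  have hqc : q ^ (γ / (γ - 1)) = q * q ^ (1 / (γ - 1)) := by
    have he : γ / (γ - 1) = 1 + 1 / (γ - 1) := by field_simp; ring
    have hne : 1 + 1 / (γ - 1) ≠ 0 := by positivity
    rw [he, Real.rpow_add' hq hne, Real.rpow_one]
  have hcd : c = q ^ (1 / (γ - 1)) * γ ^ (-(1 / (γ - 1))) := by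
    rw [hc, Real.div_rpow hq hγ1.le, Real.rpow_neg hγ1.le, div_eq_mul_inv]
  have h1 := Fstar_le hγ le_rfl (-q) hc0
  rw [hcγ] at h1
  have h2 : (γ - 1) / γ * γ ^ (-(1 / (γ - 1))) * q ^ (γ / (γ - 1)) = q * c - q / γ * c := by
    rw [hqc, hcd]
    field_simp
  rw [h2]
  linarith

section Gstar

variable {h : ℝ → ℝ} {abar : ℝ}

theorem le_Gstar (hcont : ContinuousOn h (Set.Icc 0 abar)) (p : ℝ) {a : ℝ}
    (ha : a ∈ Set.Icc 0 abar) : a + h a * p ≤ Gstar h abar p :=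
  le_csSup (isCompact_Icc.bddAbove_image
    (continuousOn_id.add (hcont.mul continuousOn_const))) ⟨a, ha, rfl⟩

theorem convexOn_Gstar (habar : 0 ≤ abar) (hcont : ContinuousOn h (Set.Icc 0 abar)) :
    ConvexOn ℝ Set.univ (Gstar h abar) := by
  refine ⟨convex_univ, fun x _ y _ a b ha hb hab => ?_⟩
  refine csSup_le ((Set.nonempty_Icc.mpr habar).image _) ?_
  rintro _ ⟨z, hz, rfl⟩
  have h1 := mul_le_mul_of_nonneg_left (le_Gstar hcont x hz) ha
  have h2 := mul_le_mul_of_nonneg_left (le_Gstar hcont y hz) hb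
  have h3 : z = (a + b) * z := by rw [hab, one_mul]
  simp only [smul_eq_mul]
  linarith

theorem continuous_Gstar (habar : 0 ≤ abar) (hcont : ContinuousOn h (Set.Icc 0 abar)) :
    Continuous (Gstar h abar) :=
  continuousOn_univ.mp ((convexOn_Gstar habar hcont).continuousOn isOpen_univ)

theorem Gstar_nonneg (habar : 0 ≤ abar) (hcont : ContinuousOn h (Set.Icc 0 abar)) (h0 : h 0 = 0)
    (p : ℝ) : 0 ≤ Gstar h abar p := by
  simpa [h0] using le_Gstar hcont p (Set.left_mem_Icc.mpr habar)

theorem continuous_integrand (habar : 0 ≤ abar) (hcont : ContinuousOn h (Set.Icc 0 abar))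
    (ρ r lam : ℝ) : Continuous fun t : ℝ =>
      ρ * Real.exp (-ρ * t) * Gstar h abar (r / ρ * lam * Real.exp ((ρ - r) * t)) :=
  (by fun_prop : Continuous fun t : ℝ => ρ * Real.exp (-ρ * t)).mul
    ((continuous_Gstar habar hcont).comp (by fun_prop))

theorem convexOn_integral_Gstar {ρ T : ℝ} (r : ℝ) (hρ : 0 ≤ ρ) (hT : 0 ≤ T) (habar : 0 ≤ abar)
    (hcont : ContinuousOn h (Set.Icc 0 abar)) :
    ConvexOn ℝ Set.univ fun lam : ℝ => ∫ t in (0 : ℝ)..T,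
      ρ * Real.exp (-ρ * t) * Gstar h abar (r / ρ * lam * Real.exp ((ρ - r) * t)) := by
  refine ⟨convex_univ, fun x _ y _ a b ha hb hab => ?_⟩
  have hi (lam : ℝ) := (continuous_integrand habar hcont ρ r lam).intervalIntegrable
    (μ := MeasureTheory.volume) 0 T
  simp only [smul_eq_mul]
  rw [← intervalIntegral.integral_const_mul, ← intervalIntegral.integral_const_mul,
    ← intervalIntegral.integral_add ((hi x).const_mul a) ((hi y).const_mul b)]
  refine intervalIntegral.integral_mono_on hT (hi _)
    (((hi x).const_mul a).add ((hi y).const_mul b)) fun t _ => ?_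
  have hG := (convexOn_Gstar habar hcont).2
    (Set.mem_univ (r / ρ * x * Real.exp ((ρ - r) * t)))
    (Set.mem_univ (r / ρ * y * Real.exp ((ρ - r) * t))) ha hb hab
  simp only [smul_eq_mul] at hG
  have hw : 0 ≤ ρ * Real.exp (-ρ * t) := by positivity
  have hG' := mul_le_mul_of_nonneg_left hG hw
  have he : r / ρ * (a * x + b * y) * Real.exp ((ρ - r) * t) =
      a * (r / ρ * x * Real.exp ((ρ - r) * t)) + b * (r / ρ * y * Real.exp ((ρ - r) * t)) := by
    ring
  rw [he]
  linarith

theorem integral_Gstar_nonneg {ρ T : ℝ} (r lam : ℝ) (hρ : 0 ≤ ρ) (hT : 0 ≤ T) (habar : 0 ≤ abar)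
    (hcont : ContinuousOn h (Set.Icc 0 abar)) (h0 : h 0 = 0) :
    0 ≤ ∫ t in (0 : ℝ)..T,
      ρ * Real.exp (-ρ * t) * Gstar h abar (r / ρ * lam * Real.exp ((ρ - r) * t)) :=
  intervalIntegral.integral_nonneg hT fun t _ =>
    mul_nonneg (by positivity) (Gstar_nonneg habar hcont h0 _)

end Gstar

theorem ConcaveOn.comp_mul_right_univ {f : ℝ → ℝ} (hf : ConcaveOn ℝ Set.univ f) (c : ℝ) :
    ConcaveOn ℝ Set.univ fun x => f (x * c) := by
  simpa [Function.comp_def] using hf.comp_linearMap (LinearMap.mulRight ℝ c)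

theorem convexOn_FGN {γ k ρ r T abar : ℝ} {h : ℝ → ℝ} {N : ℕ}
    (hγ : 1 < γ) (hk : 0 ≤ k) (hρ : 0 ≤ ρ) (hT : 0 ≤ T) (habar : 0 ≤ abar)
    (hcont : ContinuousOn h (Set.Icc 0 abar)) :
    ConvexOn ℝ Set.univ (FGN γ k ρ r T abar h N) := by
  have h1 := ((concaveOn_Fstar hγ hk).comp_mul_right_univ (Real.exp ((ρ - r) * T))).smul
    (show (0 : ℝ) ≤ N * Real.exp (-ρ * T) by positivity)
  have h2 := ((concaveOn_Fstar hγ le_rfl).comp_mul_right_univ (Real.exp ((ρ - r) * T))).smul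
    (Real.exp_nonneg (-ρ * T))
  refine ((h1.add h2).neg.add (convexOn_integral_Gstar r hρ hT habar hcont)).congr fun x _ => ?_
  simp only [FGN, Pi.add_apply, Pi.neg_apply, smul_eq_mul]
  ring

theorem rpow_add_integral_le_FGN {γ k ρ r T abar lam : ℝ} {h : ℝ → ℝ} {N : ℕ}
    (hγ : 1 < γ) (hk : 0 ≤ k) (hlam : lam ≤ 0) :
    Real.exp (-ρ * T) * ((γ - 1) / γ) * γ ^ (-(1 / (γ - 1))) *
          (-(lam * Real.exp ((ρ - r) * T))) ^ (γ / (γ - 1)) +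
        (∫ t in (0 : ℝ)..T,
          ρ * Real.exp (-ρ * t) * Gstar h abar (r / ρ * lam * Real.exp ((ρ - r) * t)))
      ≤ FGN γ k ρ r T abar h N lam := by
  have hp : lam * Real.exp ((ρ - r) * T) ≤ 0 :=
    mul_nonpos_of_nonpos_of_nonneg hlam (Real.exp_nonneg _)
  have h1 := mul_le_mul_of_nonneg_left (rpow_le_neg_Fstar hγ hp) (Real.exp_nonneg (-ρ * T))
  have h2 := mul_nonneg (show (0 : ℝ) ≤ N * Real.exp (-ρ * T) by positivity)
    (neg_nonneg.mpr (Fstar_nonpos hγ hk (lam * Real.exp ((ρ - r) * T))))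
  simp only [← mul_assoc] at h1
  rw [FGN]
  linarith

/-- `FG_N` is convex and continuous on `(−∞, 0]`, positive there,
tends to `∞` as `λ → −∞`, and satisfies the stated power lower bound. -/
theorem statement7 (γ k ρ r T abar : ℝ) (h : ℝ → ℝ) (N : ℕ)
    (hγ : 1 < γ) (hk : 0 ≤ k) (hρ : 0 < ρ) (hr : 0 < r) (hT : 0 < T) (habar : 0 < abar)
    (hcont : ContinuousOn h (Set.Icc 0 abar))
    (hmono : MonotoneOn h (Set.Icc 0 abar)) (h0 : h 0 = 0) :
    ConvexOn ℝ (Set.Iic 0) (FGN γ k ρ r T abar h N) ∧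
    ContinuousOn (FGN γ k ρ r T abar h N) (Set.Iic 0) ∧
    (∀ lam ≤ (0 : ℝ), 0 < FGN γ k ρ r T abar h N lam) ∧
    Filter.Tendsto (FGN γ k ρ r T abar h N) Filter.atBot Filter.atTop ∧
    (∀ lam ≤ (0 : ℝ),
      Real.exp (-ρ * T) * ((γ - 1) / γ) * γ ^ (-(1 / (γ - 1))) *
          (-(lam * Real.exp ((ρ - r) * T))) ^ (γ / (γ - 1))
        ≤ FGN γ k ρ r T abar h N lam) := by
  have hconv := convexOn_FGN (r := r) (N := N) hγ hk hρ.le hT.le habar.le hcont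
  have hγ0 : 0 < γ - 1 := by linarith
  have hγ1 : 0 < γ := by linarith
  have hbound : ∀ lam ≤ (0 : ℝ),
      Real.exp (-ρ * T) * ((γ - 1) / γ) * γ ^ (-(1 / (γ - 1))) *
          (-(lam * Real.exp ((ρ - r) * T))) ^ (γ / (γ - 1))
        ≤ FGN γ k ρ r T abar h N lam := fun lam hlam => by
    have h1 := rpow_add_integral_le_FGN (ρ := ρ) (r := r) (T := T) (abar := abar) (h := h)
      (N := N) hγ hk hlam
    have h2 := integral_Gstar_nonneg r lam hρ.le hT.le habar.le hcont h0
    linarith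
  refine ⟨hconv.subset (Set.subset_univ _) (convex_Iic 0),
    (hconv.continuousOn isOpen_univ).mono (Set.subset_univ _), fun lam hlam => ?_, ?_, hbound⟩
  · rcases hlam.lt_or_eq with hlt | rfl
    · refine lt_of_lt_of_le ?_ (hbound lam hlam)
      have : 0 < -(lam * Real.exp ((ρ - r) * T)) :=
        neg_pos.mpr (mul_neg_of_neg_of_pos hlt (Real.exp_pos _))
      positivity
    · refine lt_of_lt_of_le ?_ (rpow_add_integral_le_FGN hγ hk le_rfl)
      refine add_pos_of_nonneg_of_pos ?_ ?_
      · rw [zero_mul, neg_zero]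
        positivity
      · refine intervalIntegral.intervalIntegral_pos_of_pos
          ((continuous_integrand habar.le hcont ρ r 0).intervalIntegrable 0 T) (fun t => ?_) hT
        refine mul_pos (by positivity) (habar.trans_le ?_)
        simpa using le_Gstar hcont (r / ρ * 0 * Real.exp ((ρ - r) * t))
          (Set.right_mem_Icc.mpr habar.le)
  · refine Filter.tendsto_atTop_mono' _ (Filter.eventually_le_atBot (0 : ℝ) |>.mono hbound) ?_
    refine Filter.Tendsto.const_mul_atTop (by positivity) ?_
    refine (tendsto_rpow_atTop (by positivity)).comp ?_
    exact Filter.tendsto_neg_atBot_atTop.comp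
      (Filter.tendsto_id.atBot_mul_const (Real.exp_pos _))
end
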